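/- Let C be a small category and let a commutative square of presheaves on C be given, with top edge α : F' ⟶ F, left edge φ' : F' ⟶ G', right edge φ : F ⟶ G, and bottom edge β : G' ⟶ G, which is a pullback square in the category of presheaves on C. If the induced functor ∫φ : ∫F ⥤ ∫G on categories of elements has a right adjoint, then the induced functor ∫φ' : ∫F' ⥤ ∫G' also has a right adjoint. -/

import Mathlib

open CategoryTheory CategoryTheory.Limits Opposite

universe u

/-- The category of elements of a presheaf `F : Cᵒᵖ ⥤ Type u`, with objects pairs
`(c, x ∈ F(c))` and morphisms `(c, x) ⟶ (d, y)` the morphisms `f : c ⟶ d` of `C` with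
`F(f)(y) = x`. -/
structure PElt {C : Type u} [SmallCategory C] (F : Cᵒᵖ ⥤ Type u) : Type u where
  base : C
  elt : F.obj (op base)

namespace PElt

variable {C : Type u} [SmallCategory C]

instance (F : Cᵒᵖ ⥤ Type u) : Category (PElt F) where
  Hom x y := { f : x.base ⟶ y.base // F.map f.op y.elt = x.elt }
  id x := ⟨𝟙 x.base, by rw [op_id, FunctorToTypes.map_id_apply]⟩
  comp {x y z} f g := ⟨f.1 ≫ g.1, by rw [op_comp, FunctorToTypes.map_comp_apply, g.2, f.2]⟩
  id_comp f := Subtype.ext (Category.id_comp f.1)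
  comp_id f := Subtype.ext (Category.comp_id f.1)
  assoc f g h := Subtype.ext (Category.assoc f.1 g.1 h.1)

/-- The functor `∫φ : ∫F ⥤ ∫G` on categories of elements induced by a morphism of
presheaves `φ : F ⟶ G`, sending `(c, x)` to `(c, φ_c(x))`. -/
def map {F G : Cᵒᵖ ⥤ Type u} (φ : F ⟶ G) : PElt F ⥤ PElt G where
  obj x := ⟨x.base, φ.app _ x.elt⟩
  map {x y} f := ⟨f.1, by rw [← FunctorToTypes.naturality, f.2]⟩
  map_id _ := rfl
  map_comp _ _ := rfl

/-- The projection `π : ∫F ⥤ C` from the category of elements of a presheaf. -/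
def proj (F : Cᵒᵖ ⥤ Type u) : PElt F ⥤ C where
  obj x := x.base
  map f := f.1
  map_id _ := rfl
  map_comp _ _ := rfl

theorem map_comp' {F G H : Cᵒᵖ ⥤ Type u} (φ : F ⟶ G) (ψ : G ⟶ H) :
    PElt.map (φ ≫ ψ) = PElt.map φ ⋙ PElt.map ψ := rfl

end PElt

/-- A functor has a right adjoint as soon as every object of the target admits a universal
arrow from it. -/
theorem CategoryTheory.Functor.isLeftAdjoint_of_existsUnique {D E : Type*} [Category* D]
    [Category* E] (L : D ⥤ E)
    (h : ∀ A : E, ∃ (R : D) (ε : L.obj R ⟶ A), ∀ (B : D) (f : L.obj B ⟶ A),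
      ∃! g : B ⟶ R, L.map g ≫ ε = f) :
    L.IsLeftAdjoint := by
  refine isLeftAdjoint_iff_hasTerminal_costructuredArrow.2 fun A => ?_
  obtain ⟨R, ε, hε⟩ := h A
  choose g hg hg' using hε
  refine IsTerminal.hasTerminal (X := CostructuredArrow.mk ε) (IsTerminal.ofUniqueHom
    (fun B => CostructuredArrow.homMk (g _ B.hom) (hg _ _)) fun B m => ?_)
  exact CostructuredArrow.ext _ _ (hg' _ _ _ (CostructuredArrow.w m))

/-- Representable maps of presheaves are stable under pullback: if the square with top
`α`, left `φ'`, right `φ`, bottom `β` is a pullback of presheaves and `∫φ` has a right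
adjoint, then so does `∫φ'`. -/
theorem representable_stable_under_pullback {C : Type u} [SmallCategory C]
    {F F' G G' : Cᵒᵖ ⥤ Type u}
    (α : F' ⟶ F) (φ' : F' ⟶ G') (φ : F ⟶ G) (β : G' ⟶ G)
    (hpb : IsPullback α φ' φ β)
    (hφ : (PElt.map φ).IsLeftAdjoint) :
    (PElt.map φ').IsLeftAdjoint := by
  have hpb_app (c : Cᵒᵖ) : IsPullback (α.app c) (φ'.app c) (φ.app c) (β.app c) :=
    hpb.map ((evaluation Cᵒᵖ (Type u)).obj c)
  have hw {c : Cᵒᵖ} (x : F'.obj c) : φ.app c (α.app c x) = β.app c (φ'.app c x) :=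
    ConcreteCategory.congr_hom (hpb_app c).w x
  let adj := Adjunction.ofIsLeftAdjoint (PElt.map φ)
  refine Functor.isLeftAdjoint_of_existsUnique _ fun y => ?_
  let r := (PElt.map φ).rightAdjoint.obj ((PElt.map β).obj y)
  let ε : (PElt.map φ).obj r ⟶ (PElt.map β).obj y := adj.counit.app _
  have hε : φ.app _ r.elt = β.app _ (G'.map ε.1.op y.elt) :=
    ε.2.symm.trans (NatTrans.naturality_apply β ε.1.op y.elt).symm
  obtain ⟨z, hαz, hφz⟩ := Types.exists_of_isPullback (hpb_app _) _ _ hε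
  refine ⟨⟨r.base, z⟩, ⟨ε.1, hφz.symm⟩, fun x f => ?_⟩
  let f₀ : (PElt.map φ).obj ((PElt.map α).obj x) ⟶ (PElt.map β).obj y :=
    ⟨f.1, ((NatTrans.naturality_apply β f.1.op y.elt).symm.trans
      (congrArg (β.app _) f.2)).trans (hw x.elt).symm⟩
  let g : (PElt.map α).obj x ⟶ r := adj.homEquiv _ _ f₀
  have hg : (PElt.map φ).map g ≫ ε = f₀ :=
    (adj.homEquiv_counit ..).symm.trans ((adj.homEquiv _ _).symm_apply_apply f₀)
  have hgf : g.1 ≫ ε.1 = f.1 := congrArg Subtype.val hg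
  refine ⟨⟨g.1, ?_⟩, Subtype.ext hgf, fun g' (hg' : (PElt.map φ').map g' ≫ _ = f) => ?_⟩
  · refine Types.ext_of_isPullback (hpb_app _) ?_ ?_
    · rw [NatTrans.naturality_apply, hαz]
      exact g.2
    · rw [NatTrans.naturality_apply, hφz]
      exact ((Functor.map_comp_apply G' ε.1.op g.1.op y.elt).symm.trans
        (congrArg (fun h => G'.map h.op y.elt) hgf)).trans f.2
  · let k : (PElt.map α).obj x ⟶ r := ⟨g'.1, by
      rw [← hαz]
      exact ((PElt.map α).map g').2⟩
    have hgf' : g'.1 ≫ ε.1 = f.1 := congrArg Subtype.val hg'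
    have hk : (PElt.map φ).map k ≫ ε = f₀ := Subtype.ext hgf'
    have hkg : k = g := (adj.homEquiv _ _).symm.injective
      (((adj.homEquiv_counit ..).trans (hk.trans hg.symm)).trans (adj.homEquiv_counit ..).symm)
    have hval : g'.1 = g.1 := congrArg Subtype.val hkg
    exact Subtype.ext hval
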